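/- The integral homology of 𝔫𝔦𝔩_5 is: H_0 ≅ ℤ, H_1 ≅ ℤ^4, H_2 ≅ ℤ^9 ⊕ (ℤ/2)^2, H_3 ≅ ℤ^{15} ⊕ (ℤ/2)^8 ⊕ (ℤ/3)^2, H_4 ≅ ℤ^{20} ⊕ (ℤ/2)^{10} ⊕ (ℤ/3)^3, H_5 ≅ ℤ^{22} ⊕ (ℤ/2)^{10} ⊕ (ℤ/3)^3, H_6 ≅ ℤ^{20} ⊕ (ℤ/2)^8 ⊕ (ℤ/3)^2, H_7 ≅ ℤ^{15} ⊕ (ℤ/2)^2, H_8 ≅ ℤ^9, H_9 ≅ ℤ^4, H_{10} ≅ ℤ, and H_k = 0 for k > 10. -/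

import Mathlib

namespace Nil

/-- Index pairs `(a,b)` with `a < b` in `Fin n`, indexing the basis `e_{ab}` of `nil_n`. -/
abbrev P (n : ℕ) : Type := {p : Fin n × Fin n // p.1 < p.2}

/-- Lexicographic key of a pair. -/
def key {n : ℕ} (p : P n) : ℕ := p.1.1.1 * n + p.1.2.1

/-- Position (0-based) of `a` in the lexicographically sorted list of `M`. -/
def pos {n : ℕ} (M : Finset (P n)) (a : P n) : ℕ :=
  (M.filter fun b => key b < key a).card

/-- Basis of the degree `k` part of the Chevalley-Eilenberg complex `Λ^* nil_n`:
subsets `M` of pairs with `|M| = k` (empty for `k < 0`). -/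
abbrev B (n : ℕ) (k : ℤ) : Type := {M : Finset (P n) // (M.card : ℤ) = k}

/-- Degree `k` chain group of the Chevalley-Eilenberg complex of `nil_n`. -/
abbrev C (n : ℕ) (k : ℤ) : Type := B n k →₀ ℤ

/-- The Chevalley-Eilenberg boundary of a basis wedge `e_M`:
`∂(e_{a₁b₁} ∧ … ∧ e_{aₖbₖ}) = Σ_{i<j} (-1)^{i+j} [e_{aᵢbᵢ}, e_{aⱼbⱼ}] ∧ …` (omitting
the i-th and j-th factors), written in the lexicographically sorted basis.
For lexicographically sorted wedges the only nonzero brackets come from pairs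
`a = (x,y)`, `b = (y,z)`, producing `±e_{(x,z)}`. -/
noncomputable def dAux {n : ℕ} (k : ℤ) (M : Finset (P n)) : C n k :=
  ∑ a ∈ M, ∑ b ∈ M,
    if hab : a.1.2 = b.1.1 then
      (let c : P n := ⟨(a.1.1, b.1.2), lt_trans a.2 (by rw [hab]; exact b.2)⟩
       let M' : Finset (P n) := insert c ((M.erase a).erase b)
       if h' : (M'.card : ℤ) = k then
         ((-1 : ℤ) ^ (pos M a + pos M b + pos M' c)) • Finsupp.single (⟨M', h'⟩ : B n k) 1
       else 0)
    else 0

/-- The Chevalley-Eilenberg boundary map in degree `k+1`. -/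
noncomputable def d (n : ℕ) (k : ℤ) : C n (k + 1) →ₗ[ℤ] C n k :=
  Finsupp.lsum ℤ fun M => LinearMap.toSpanSingleton ℤ (C n k) (dAux k M.1)

/-- Degree-cast isomorphism. -/
noncomputable def castC (n : ℕ) {k l : ℤ} (h : k = l) : C n k ≃ₗ[ℤ] C n l :=
  Finsupp.domLCongr (Equiv.subtypeEquivRight fun _ => by rw [h])

/-- The boundary map out of degree `k`. -/
noncomputable def dFrom (n : ℕ) (k : ℤ) : C n k →ₗ[ℤ] C n (k - 1) :=
  (d n (k - 1)).comp (castC n (by ring : k = k - 1 + 1)).toLinearMap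

/-- Cycles of `Λ^* nil_n` in degree `k`. -/
noncomputable def Zfull (n : ℕ) (k : ℤ) : Submodule ℤ (C n k) := LinearMap.ker (dFrom n k)

noncomputable def HnilSub (n : ℕ) (k : ℤ) : Submodule ℤ (Zfull n k) :=
  Submodule.comap (Zfull n k).subtype (LinearMap.range (d n k) ⊓ Zfull n k)

/-- `H_k(nil_n; ℤ)`: the `k`-th integral homology of the Chevalley-Eilenberg complex
of the Lie ring of strictly upper triangular `n × n` integer matrices. -/
noncomputable def Hnil (n : ℕ) (k : ℤ) : Type := Zfull n k ⧸ HnilSub n k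

noncomputable instance (n : ℕ) (k : ℤ) : AddCommGroup (Hnil n k) :=
  inferInstanceAs (AddCommGroup (Zfull n k ⧸ HnilSub n k))

noncomputable instance (n : ℕ) (k : ℤ) : Module ℤ (Hnil n k) :=
  inferInstanceAs (Module ℤ (Zfull n k ⧸ HnilSub n k))

/-- The modified weight of a basis wedge `e_M` (indices of `Fin n` are 0-based, so the
`i`-th weight of the paper, `1 ≤ i ≤ n`, is `wt M ⟨i-1,_⟩`):
`w_i(e_M) = i - #{x : (x,i) ∈ M} + #{y : (i,y) ∈ M}`. -/
def wt {n : ℕ} (M : Finset (P n)) : Fin n → ℤ := fun i =>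
  ((i.1 : ℤ) + 1) - (M.filter fun p => p.1.2 = i).card + (M.filter fun p => p.1.1 = i).card

/-- Basis wedges of degree `k` and modified weight `w`. -/
abbrev Bw (n : ℕ) (k : ℤ) (w : Fin n → ℤ) : Type :=
  {M : Finset (P n) // (M.card : ℤ) = k ∧ wt M = w}

/-- Degree `k` part of the weight summand `⟦w⟧` of `Λ^* nil_n`. -/
abbrev Cw (n : ℕ) (k : ℤ) (w : Fin n → ℤ) : Type := Bw n k w →₀ ℤ

/-- Inclusion of the weight summand. -/
noncomputable def inclW (n : ℕ) (k : ℤ) (w : Fin n → ℤ) : Cw n k w →ₗ[ℤ] C n k :=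
  Finsupp.lmapDomain ℤ ℤ fun M => (⟨M.1, M.2.1⟩ : B n k)

/-- Projection onto the weight summand. -/
noncomputable def projW (n : ℕ) (k : ℤ) (w : Fin n → ℤ) : C n k →ₗ[ℤ] Cw n k w :=
  Finsupp.lsum ℤ fun M =>
    if h : wt M.1 = w then
      LinearMap.toSpanSingleton ℤ (Cw n k w) (Finsupp.single (⟨M.1, M.2, h⟩ : Bw n k w) 1)
    else 0

/-- The boundary of the weight summand `⟦w⟧` (the boundary preserves weights, so this
is the restriction of the Chevalley-Eilenberg boundary). -/
noncomputable def dW (n : ℕ) (k : ℤ) (w : Fin n → ℤ) : Cw n (k + 1) w →ₗ[ℤ] Cw n k w :=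
  (projW n k w) ∘ₗ (d n k) ∘ₗ (inclW n (k + 1) w)

noncomputable def castCw (n : ℕ) (w : Fin n → ℤ) {k l : ℤ} (h : k = l) :
    Cw n k w ≃ₗ[ℤ] Cw n l w :=
  Finsupp.domLCongr (Equiv.subtypeEquivRight fun _ => by rw [h])

noncomputable def dFromW (n : ℕ) (k : ℤ) (w : Fin n → ℤ) : Cw n k w →ₗ[ℤ] Cw n (k - 1) w :=
  (dW n (k - 1) w).comp (castCw n w (by ring : k = k - 1 + 1)).toLinearMap

noncomputable def ZW (n : ℕ) (k : ℤ) (w : Fin n → ℤ) : Submodule ℤ (Cw n k w) :=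
  LinearMap.ker (dFromW n k w)

noncomputable def HwSub (n : ℕ) (k : ℤ) (w : Fin n → ℤ) : Submodule ℤ (ZW n k w) :=
  Submodule.comap (ZW n k w).subtype (LinearMap.range (dW n k w) ⊓ ZW n k w)

/-- `H_k⟦w⟧`: the `k`-th homology of the weight summand `⟦w⟧` of `Λ^* nil_n`. -/
noncomputable def Hw (n : ℕ) (k : ℤ) (w : Fin n → ℤ) : Type := ZW n k w ⧸ HwSub n k w

noncomputable instance (n : ℕ) (k : ℤ) (w : Fin n → ℤ) : AddCommGroup (Hw n k w) :=
  inferInstanceAs (AddCommGroup (ZW n k w ⧸ HwSub n k w))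

noncomputable instance (n : ℕ) (k : ℤ) (w : Fin n → ℤ) : Module ℤ (Hw n k w) :=
  inferInstanceAs (Module ℤ (ZW n k w ⧸ HwSub n k w))

/-- `w ∈ 𝒮_n`: all entries lie in `{1,…,n}` and they add up to `binom (n+1) 2`. -/
def Sn (n : ℕ) (w : Fin n → ℤ) : Prop :=
  (∀ i, 1 ≤ w i ∧ w i ≤ (n : ℤ)) ∧ 2 * ∑ i, w i = (n : ℤ) * ((n : ℤ) + 1)

/-- Number of inversions of a permutation of `Fin n`. -/
def invCount (n : ℕ) (π : Equiv.Perm (Fin n)) : ℕ :=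
  (Finset.univ.filter fun p : Fin n × Fin n => p.1 < p.2 ∧ π p.2 < π p.1).card

/-- The weight sequence `(π(1), …, π(n))` attached to a permutation (1-based values). -/
def permWt (n : ℕ) (π : Equiv.Perm (Fin n)) : Fin n → ℤ := fun i => ((π i).1 : ℤ) + 1

/-- The set of inversions of a permutation, as a set of index pairs. -/
def invFinset {n : ℕ} (π : Equiv.Perm (Fin n)) : Finset (P n) :=
  Finset.univ.filter fun p => π p.1.2 < π p.1.1

/-- Index reversal `i ↦ n+1-i` (0-based: `i ↦ n-1-i`). -/
def rev {n : ℕ} (i : Fin n) : Fin n := ⟨n - 1 - i.1, by have := i.isLt; omega⟩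



/-- Integer combinations of basis wedges, each wedge being encoded by the bit mask of its set of
index pairs. -/
abbrev Vec : Type := List (ℕ × ℤ)

/-- Number of bits of `m` below position `j`. -/
def pop (m : ℕ) : ℕ → ℕ
  | 0 => 0
  | j + 1 => pop m j + (m.testBit j).toNat

/-- An ordering of the masks `m < 1024` for which column reduction meets no pivot obstruction. -/
def rank (m : ℕ) : ℕ := 1001 * m % 1024

/-- Add the term `c • m` to a combination sorted by decreasing rank. -/
def addTerm (m : ℕ) (c : ℤ) : Vec → Vec
  | [] => [(m, c)]
  | (n, e) :: v =>
    if m = n then (if c + e = 0 then v else (n, c + e) :: v)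
    else if rank n < rank m then (m, c) :: (n, e) :: v
    else (n, e) :: addTerm m c v

/-- `axpy c u v` represents `c • u + v`. -/
def axpy (c : ℤ) (u v : Vec) : Vec := u.foldr (fun t => addTerm t.1 (c * t.2)) v

/-- The positions of the pairs `(x,y)`, `(y,z)`, `(x,z)` for all `x < y < z`. -/
def brackets : List (ℕ × ℕ × ℕ) :=
  [(0, 4, 1), (0, 5, 2), (0, 6, 3), (1, 7, 2), (1, 8, 3), (2, 9, 3), (4, 7, 5), (4, 8, 6),
    (5, 9, 6), (7, 9, 8)]

/-- Replace the factors `a`, `b` of the wedge `m` by `c`. -/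
def swap (m : ℕ) (t : ℕ × ℕ × ℕ) : ℕ := m ^^^ 2 ^ t.1 ^^^ 2 ^ t.2.1 ^^^ 2 ^ t.2.2

/-- The contribution of one bracket to the boundary of the wedge `m`. -/
def bracketTerm (m : ℕ) (t : ℕ × ℕ × ℕ) : Vec :=
  if m &&& (2 ^ t.1 ||| 2 ^ t.2.1 ||| 2 ^ t.2.2) = 2 ^ t.1 ||| 2 ^ t.2.1 then
    [(swap m t,
      if (pop m t.1 + pop m t.2.1 + pop (swap m t) t.2.2) % 2 = 0 then 1 else -1)]
  else []

/-- Boundary of a wedge. -/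
def bdTerm (m : ℕ) : Vec := brackets.flatMap (bracketTerm m)

/-- Boundary of a combination, sorted. -/
def bd (v : Vec) : Vec := v.foldr (fun t => axpy t.2 (bdTerm t.1)) []

/-- A basis vector `vec` with `∂ vec = coeff • vec'`, where `vec'` belongs to the partner. -/
structure Entry where
  vec : Vec
  coeff : ℤ
  partner : ℕ

/-- Binary tries, addressed by the bits of a natural number. -/
inductive Trie where
  | nil
  | leaf (e : Entry)
  | node (l r : Trie)

namespace Trie

def get? : Trie → ℕ → Option Entry
  | nil, _ => none
  | leaf e, _ => some e
  | node l r, m => if m % 2 = 0 then l.get? (m / 2) else r.get? (m / 2)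

def set (e : Entry) : ℕ → Trie → ℕ → Trie
  | 0, _, _ => leaf e
  | j + 1, node l r, m =>
    if m % 2 = 0 then node (set e j l (m / 2)) r else node l (set e j r (m / 2))
  | j + 1, _, m =>
    if m % 2 = 0 then node (set e j nil (m / 2)) nil else node nil (set e j nil (m / 2))

end Trie

/-- Column reduction of `v` and its boundary `r` against the pairs found so far. -/
def reduce (T : Trie) : ℕ → Vec → Vec → Vec × Vec
  | 0, v, r => (v, r)
  | _ + 1, v, [] => (v, [])
  | j + 1, v, (i, c) :: r =>
    match T.get? i with
    | none => (v, (i, c) :: r)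
    | some e =>
      match T.get? e.partner with
      | none => (v, (i, c) :: r)
      | some f =>
        if f.coeff = 0 then (v, (i, c) :: r)
        else reduce T j (axpy (-(c / f.coeff)) f.vec v) (axpy (-c) e.vec ((i, c) :: r))

/-- Process the column of the wedge `m`. -/
def step (T : Trie) (m : ℕ) : Trie :=
  match T.get? m with
  | some _ => T
  | none =>
    match reduce T 16 [(m, 1)] (bd [(m, 1)]) with
    | (v, []) => T.set ⟨v, 0, m⟩ 10 m
    | (v, (i, c) :: r) =>
      (T.set ⟨v, c, i⟩ 10 m).set ⟨((i, c) :: r).map fun t => (t.1, t.2 / c), 0, m⟩ 10 i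

/-- Process columns in turn. The case distinction makes the kernel evaluate each step before it
proceeds to the next. -/
def steps : List ℕ → Trie → Trie
  | [], T => T
  | m :: l, T =>
    match step T m with
    | .nil => .nil
    | .leaf e => steps l (.leaf e)
    | .node t₀ t₁ => steps l (.node t₀ t₁)

/-- The outcome of the reduction, in order of increasing rank. -/
def table : Trie := steps ((List.range 1024).map fun j => 89 * j % 1024) .nil

def entry (m : ℕ) : Entry := (table.get? m).getD ⟨[], 0, 0⟩

/-- The entry of `m` has leading term `m`, and is correctly matched to that of its partner. -/
def checkEntry (m : ℕ) (e f : Entry) : Bool :=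
  (match e.vec with
    | [] => false
    | (n, c) :: v => n == m && c == 1 && v.all fun t => t.1 < 1024 && rank t.1 < rank m) &&
  e.partner < 1024 && f.partner == m && e.coeff.natAbs < 4 &&
  if e.coeff = 0 then bd e.vec == []
  else f.coeff == 0 && bd e.vec == axpy e.coeff f.vec [] && pop m 10 == pop e.partner 10 + 1

def check (m : ℕ) : Bool := checkEntry m (entry m) (entry (entry m).partner)

theorem check_eq_true {m : ℕ} (hm : m < 1024) : check m = true := by
  have h : ∀ i < 32, ∀ j < 32, check (32 * i + j) = true := by decide +kernel
  have := h (m / 32) (by omega) (m % 32) (by omega)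
  rwa [Nat.div_add_mod] at this

/-- The order of the homology class of the cycle in the entry of `m`; it is `0` for infinite order,
and `1` if the entry contains no cycle. -/
def order (m : ℕ) : ℕ :=
  if (entry m).coeff = 0 then (entry (entry m).partner).coeff.natAbs else 1

/-- The masks whose entries contain a cycle that is not a boundary. -/
def essential : List ℕ := (List.range 1024).filter fun m => order m != 1

/-- The number of nontrivial cycles of degree `k` and order `c`. -/
def numCycles (k c : ℕ) : ℕ :=
  (essential.filter fun m => pop m 10 == k).countP fun m => order m == c

theorem numCycles_eq : (List.range 11).map (fun k => [numCycles k 0, numCycles k 2, numCycles k 3]) =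
    [[1, 0, 0], [4, 0, 0], [9, 2, 0], [15, 8, 2], [20, 10, 3], [22, 10, 3], [20, 8, 2], [15, 2, 0],
      [9, 0, 0], [4, 0, 0], [1, 0, 0]] := by
  decide +kernel

/-- Position of an index pair in the lexicographic order. -/
def bit (p : P 5) : ℕ := p.1.1.1 * (7 - p.1.1.1) / 2 + p.1.2.1 - 1

theorem bit_lt : ∀ p, bit p < 10 := by decide

theorem bit_injective : Function.Injective bit := by
  have : ∀ p q, bit p = bit q → p = q := by decide
  exact this

theorem exists_bit : ∀ i < 10, ∃ p, bit p = i := by decide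

theorem key_lt_iff : ∀ p q : P 5, key q < key p ↔ bit q < bit p := by decide

/-- The set of index pairs encoded by a mask. -/
def ofMask (m : ℕ) : Finset (P 5) := Finset.univ.filter fun p => m.testBit (bit p)

theorem mem_ofMask {m : ℕ} {p : P 5} : p ∈ ofMask m ↔ m.testBit (bit p) = true := by
  simp [ofMask]

theorem pop_eq_card (m j : ℕ) :
    pop m j = ((Finset.range j).filter fun i => m.testBit i).card := by
  induction j with
  | zero => rfl
  | succ j ih =>
    rw [pop, ih, Finset.range_add_one, Finset.filter_insert]
    split_ifs with h <;> simp [h]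

theorem card_filter_ofMask (m j : ℕ) (hj : j ≤ 10) :
    ((ofMask m).filter fun q => bit q < j).card = pop m j := by
  rw [pop_eq_card]
  refine Finset.card_nbij bit ?_ bit_injective.injOn ?_
  · intro q hq
    simpa [mem_ofMask, and_comm] using hq
  · intro i hi
    simp only [Finset.coe_filter, Finset.mem_range, Set.mem_ofPred_eq] at hi
    obtain ⟨p, rfl⟩ := exists_bit i (by omega)
    exact ⟨p, by simpa [mem_ofMask, and_comm] using hi, rfl⟩

theorem pos_ofMask (m : ℕ) (p : P 5) : pos (ofMask m) p = pop m (bit p) := by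
  simp only [pos, key_lt_iff]
  exact card_filter_ofMask m _ (bit_lt p).le

theorem card_ofMask (m : ℕ) : (ofMask m).card = pop m 10 := by
  rw [← card_filter_ofMask m 10 le_rfl, Finset.filter_true_of_mem fun q _ => bit_lt q]

theorem ofMask_swap {m : ℕ} {p q r : P 5} (hp : p ∈ ofMask m) (hq : q ∈ ofMask m)
    (hr : r ∉ ofMask m) (hpq : p ≠ q) :
    ofMask (swap m (bit p, bit q, bit r)) = insert r (((ofMask m).erase p).erase q) := by
  ext x
  rw [mem_ofMask] at hp hq hr
  simp only [mem_ofMask, swap, Nat.testBit_xor, Nat.testBit_two_pow, Finset.mem_insert,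
    Finset.mem_erase, bit_injective.eq_iff]
  grind

theorem and_eq_iff {m a b c : ℕ} (hac : a ≠ c) (hbc : b ≠ c) :
    m &&& (2 ^ a ||| 2 ^ b ||| 2 ^ c) = 2 ^ a ||| 2 ^ b ↔
      m.testBit a ∧ m.testBit b ∧ m.testBit c = false := by
  constructor
  · intro h
    have key (i : ℕ) := congrArg (Nat.testBit · i) h
    simp only [Nat.testBit_and, Nat.testBit_or, Nat.testBit_two_pow] at key
    refine ⟨by simpa using key a, by simpa using key b, by simpa [hac, hbc] using key c⟩
  · rintro ⟨ha, hb, hc⟩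
    refine Nat.eq_of_testBit_eq fun i => ?_
    simp only [Nat.testBit_and, Nat.testBit_or, Nat.testBit_two_pow]
    by_cases hia : a = i <;> by_cases hib : b = i <;> by_cases hic : c = i <;> simp_all

/-- The basis wedge encoded by a mask, if it has degree `k`. -/
noncomputable def wedge (k : ℤ) (m : ℕ) : C 5 k :=
  if h : ((ofMask m).card : ℤ) = k then Finsupp.single ⟨ofMask m, h⟩ 1 else 0

/-- The degree `k` part of the chain represented by a combination of masks. -/
noncomputable def eval (k : ℤ) (v : Vec) : C 5 k := (v.map fun t => t.2 • wedge k t.1).sum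

@[simp] theorem eval_nil (k : ℤ) : eval k [] = 0 := rfl

@[simp] theorem eval_cons (k : ℤ) (t : ℕ × ℤ) (v : Vec) :
    eval k (t :: v) = t.2 • wedge k t.1 + eval k v := by
  simp [eval]

theorem eval_append (k : ℤ) (u v : Vec) : eval k (u ++ v) = eval k u + eval k v := by
  simp [eval]

theorem eval_addTerm (k : ℤ) (m : ℕ) (c : ℤ) (v : Vec) :
    eval k (addTerm m c v) = c • wedge k m + eval k v := by
  induction v with
  | nil => simp [addTerm]
  | cons t v ih =>
    obtain ⟨n, e⟩ := t
    simp only [addTerm]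
    split_ifs with h₁ h₂ h₃
    · subst h₁
      rw [eval_cons, ← add_assoc, ← add_smul, h₂, zero_smul, zero_add]
    · subst h₁
      rw [eval_cons, eval_cons, ← add_assoc, ← add_smul]
    · simp
    · rw [eval_cons, eval_cons, ih, add_left_comm]

theorem eval_axpy (k : ℤ) (c : ℤ) (u v : Vec) :
    eval k (axpy c u v) = c • eval k u + eval k v := by
  induction u with
  | nil => simp [axpy]
  | cons t u ih =>
    rw [axpy, List.foldr_cons, eval_addTerm, ← axpy, ih, eval_cons, smul_add, mul_smul, add_assoc]

/-- All triples `(x,y)`, `(y,z)`, `(x,z)` of index pairs. -/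
def triples : List (P 5 × P 5 × P 5) :=
  [(⟨(0, 1), by decide⟩, ⟨(1, 2), by decide⟩, ⟨(0, 2), by decide⟩),
    (⟨(0, 1), by decide⟩, ⟨(1, 3), by decide⟩, ⟨(0, 3), by decide⟩),
    (⟨(0, 1), by decide⟩, ⟨(1, 4), by decide⟩, ⟨(0, 4), by decide⟩),
    (⟨(0, 2), by decide⟩, ⟨(2, 3), by decide⟩, ⟨(0, 3), by decide⟩),
    (⟨(0, 2), by decide⟩, ⟨(2, 4), by decide⟩, ⟨(0, 4), by decide⟩),
    (⟨(0, 3), by decide⟩, ⟨(3, 4), by decide⟩, ⟨(0, 4), by decide⟩),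
    (⟨(1, 2), by decide⟩, ⟨(2, 3), by decide⟩, ⟨(1, 3), by decide⟩),
    (⟨(1, 2), by decide⟩, ⟨(2, 4), by decide⟩, ⟨(1, 4), by decide⟩),
    (⟨(1, 3), by decide⟩, ⟨(3, 4), by decide⟩, ⟨(1, 4), by decide⟩),
    (⟨(2, 3), by decide⟩, ⟨(3, 4), by decide⟩, ⟨(2, 4), by decide⟩)]

theorem brackets_eq : brackets = triples.map fun t => (bit t.1, bit t.2.1, bit t.2.2) := rfl

theorem nodup_triples : (triples.map fun t => (t.1, t.2.1)).Nodup := by decide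

theorem filter_composable :
    (Finset.univ.filter fun x : P 5 × P 5 => x.1.1.2 = x.2.1.1) =
      (triples.map fun t => (t.1, t.2.1)).toFinset := by decide

theorem composable_of_mem_triples : ∀ t ∈ triples,
    t.1.1.2 = t.2.1.1.1 ∧ t.2.2.1 = (t.1.1.1, t.2.1.1.2) := by decide

theorem ne_of_mem_triples : ∀ t ∈ triples, t.1 ≠ t.2.1 ∧ t.1 ≠ t.2.2 ∧ t.2.1 ≠ t.2.2 := by decide

theorem sum_sum_eq_sum_triples {A : Type*} [AddCommMonoid A] (M : Finset (P 5))
    (F : P 5 → P 5 → A) (hF : ∀ a b, a.1.2 ≠ b.1.1 → F a b = 0) :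
    ∑ a ∈ M, ∑ b ∈ M, F a b =
      (triples.map fun t => if t.1 ∈ M ∧ t.2.1 ∈ M then F t.1 t.2.1 else 0).sum := by
  have h := List.sum_toFinset
    (fun x : P 5 × P 5 => if x.1 ∈ M ∧ x.2 ∈ M then F x.1 x.2 else 0) nodup_triples
  rw [List.map_map] at h
  refine Eq.trans ?_ h
  rw [← filter_composable, ← Finset.sum_product', ← Finset.sum_filter, Finset.filter_filter]
  symm
  refine Finset.sum_subset (fun x hx => ?_) fun x hx hx' => hF _ _ fun hc => hx' ?_
  · simp only [Finset.mem_filter] at hx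
    simpa using hx.2.2
  · simp only [Finset.mem_filter, Finset.mem_univ, true_and]
    exact ⟨hc, by simpa using hx⟩

theorem dAux_ofMask (k : ℤ) (m : ℕ) (hm : ((ofMask m).card : ℤ) = k + 1) :
    dAux k (ofMask m) = eval k (bdTerm m) := by
  rw [dAux, sum_sum_eq_sum_triples _ _ fun a b hab => dif_neg hab, bdTerm, brackets_eq]
  have aux : ∀ l : List (P 5 × P 5 × P 5), (∀ t ∈ l, t ∈ triples) →
      eval k ((l.map fun t => (bit t.1, bit t.2.1, bit t.2.2)).flatMap (bracketTerm m)) =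
        (l.map fun t => eval k (bracketTerm m (bit t.1, bit t.2.1, bit t.2.2))).sum := by
    intro l hl
    induction l with
    | nil => rfl
    | cons t l ih =>
      simp only [List.map_cons, List.flatMap_cons, List.sum_cons, eval_append]
      rw [ih fun t ht => hl t (List.mem_cons_of_mem _ ht)]
  rw [aux _ fun t ht => ht]
  refine congrArg List.sum (List.map_congr_left fun t ht => ?_)
  obtain ⟨a, b, c⟩ := t
  obtain ⟨hab, hc⟩ := composable_of_mem_triples _ ht
  obtain ⟨nab, nac, nbc⟩ := ne_of_mem_triples _ ht
  dsimp only at hab hc nab nac nbc ⊢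
  have hc' : (⟨(a.1.1, b.1.2), lt_trans a.2 (by rw [hab]; exact b.2)⟩ : P 5) = c :=
    Subtype.ext hc.symm
  rw [dif_pos hab, hc', bracketTerm]
  simp only [and_eq_iff (bit_injective.ne nac) (bit_injective.ne nbc)]
  by_cases h : a ∈ ofMask m ∧ b ∈ ofMask m
  · rw [if_pos h]
    obtain ⟨ha, hb⟩ := h
    by_cases hcm : c ∈ ofMask m
    · rw [dif_neg, if_neg fun h => by simp [mem_ofMask.1 hcm] at h, eval_nil]
      intro hk
      rw [Finset.insert_eq_of_mem (by simp [hcm, nac.symm, nbc.symm]),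
        Finset.card_erase_of_mem (by simp [hb, nab.symm]), Finset.card_erase_of_mem ha] at hk
      have : 0 < ((ofMask m).erase a).card := Finset.card_pos.2 ⟨b, by simp [hb, nab.symm]⟩
      rw [Finset.card_erase_of_mem ha] at this
      omega
    · rw [if_pos ⟨mem_ofMask.1 ha, mem_ofMask.1 hb, by simpa [mem_ofMask] using hcm⟩]
      simp only [eval_cons, eval_nil, add_zero, wedge, ← ofMask_swap ha hb hcm nab, pos_ofMask]
      split_ifs with h₁ h₂ h₂
      · rw [(Nat.even_iff.2 h₂).neg_one_pow]
      · rw [(Nat.odd_iff.2 (by omega)).neg_one_pow]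
      all_goals simp
  · rw [if_neg h, if_neg fun h' => h ⟨mem_ofMask.2 h'.1, mem_ofMask.2 h'.2.1⟩, eval_nil]

theorem card_of_mem_bdTerm {m : ℕ} {t : ℕ × ℤ} (ht : t ∈ bdTerm m) :
    (ofMask t.1).card + 1 = (ofMask m).card := by
  simp only [bdTerm, brackets_eq, List.mem_flatMap, List.mem_map] at ht
  obtain ⟨_, ⟨⟨a, b, c⟩, habc, rfl⟩, ht⟩ := ht
  obtain ⟨nab, nac, nbc⟩ := ne_of_mem_triples _ habc
  rw [bracketTerm] at ht
  simp only [and_eq_iff (bit_injective.ne nac) (bit_injective.ne nbc)] at ht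
  by_cases h : m.testBit (bit a) ∧ m.testBit (bit b) ∧ m.testBit (bit c) = false
  · have ha := mem_ofMask.2 h.1
    have hb := mem_ofMask.2 h.2.1
    have hc : c ∉ ofMask m := by simp [mem_ofMask, h.2.2]
    have hb' : b ∈ (ofMask m).erase a := Finset.mem_erase.2 ⟨nab.symm, hb⟩
    rw [if_pos h, List.mem_singleton] at ht
    rw [ht, ofMask_swap ha hb hc nab, Finset.card_insert_of_notMem (by simp [hc]),
      Finset.card_erase_add_one hb', Finset.card_erase_add_one ha]
  · simp [if_neg h] at ht

theorem d_wedge (k : ℤ) (m : ℕ) : d 5 k (wedge (k + 1) m) = eval k (bdTerm m) := by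
  by_cases h : ((ofMask m).card : ℤ) = k + 1
  · rw [wedge, dif_pos h, d, Finsupp.lsum_single, LinearMap.toSpanSingleton_apply, one_smul,
      dAux_ofMask k m h]
  · rw [wedge, dif_neg h, map_zero, eval, List.sum_eq_zero]
    simp only [List.mem_map]
    rintro _ ⟨t, ht, rfl⟩
    have := card_of_mem_bdTerm ht
    rw [wedge, dif_neg (by omega), smul_zero]

theorem d_eval (k : ℤ) (v : Vec) : d 5 k (eval (k + 1) v) = eval k (bd v) := by
  induction v with
  | nil => simp [bd]
  | cons t v ih =>
    rw [eval_cons, map_add, map_smul, d_wedge, ih, bd, bd, List.foldr_cons, eval_axpy]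

theorem castC_eval {k l : ℤ} (h : k = l) (v : Vec) : castC 5 h (eval k v) = eval l v := by
  subst h
  have : castC 5 (rfl : k = k) = LinearEquiv.refl ℤ _ := by
    ext x M
    exact congrArg x (Subtype.ext rfl)
  simp [this]

theorem dFrom_eval (k : ℤ) (v : Vec) : dFrom 5 k (eval k v) = eval (k - 1) (bd v) := by
  rw [dFrom, LinearMap.comp_apply, LinearEquiv.coe_coe, castC_eval, d_eval]

attribute [irreducible] entry order

theorem entry_vec {m : ℕ} (hm : m < 1024) :
    ∃ v, (entry m).vec = (m, 1) :: v ∧ ∀ t ∈ v, t.1 < 1024 ∧ rank t.1 < rank m := by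
  have h := check_eq_true hm
  simp only [check, checkEntry, Bool.and_eq_true] at h
  have h := h.1.1.1.1
  split at h
  · simp at h
  · next n c v hv =>
    simp only [Bool.and_eq_true, beq_iff_eq, List.all_eq_true, decide_eq_true_eq] at h
    obtain ⟨⟨rfl, rfl⟩, h⟩ := h
    exact ⟨v, hv, h⟩

theorem partner_lt {m : ℕ} (hm : m < 1024) : (entry m).partner < 1024 := by
  have h := check_eq_true hm
  simp only [check, checkEntry, Bool.and_eq_true, decide_eq_true_eq] at h
  exact h.1.1.1.2

theorem partner_partner {m : ℕ} (hm : m < 1024) : (entry (entry m).partner).partner = m := by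
  have h := check_eq_true hm
  simp only [check, checkEntry, Bool.and_eq_true, beq_iff_eq] at h
  exact h.1.1.2

theorem natAbs_coeff_lt {m : ℕ} (hm : m < 1024) : (entry m).coeff.natAbs < 4 := by
  have h := check_eq_true hm
  simp only [check, checkEntry, Bool.and_eq_true, decide_eq_true_eq] at h
  exact h.1.2

theorem bd_vec_of_coeff_eq_zero {m : ℕ} (hm : m < 1024) (h₀ : (entry m).coeff = 0) :
    bd (entry m).vec = [] := by
  have h := check_eq_true hm
  simp only [check, checkEntry, Bool.and_eq_true, if_pos h₀, beq_iff_eq] at h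
  exact h.2

theorem of_coeff_ne_zero {m : ℕ} (hm : m < 1024) (h₀ : (entry m).coeff ≠ 0) :
    (entry (entry m).partner).coeff = 0 ∧
      bd (entry m).vec = axpy (entry m).coeff (entry (entry m).partner).vec [] ∧
      (ofMask m).card = (ofMask (entry m).partner).card + 1 := by
  have h := check_eq_true hm
  simp only [check, checkEntry, Bool.and_eq_true, if_neg h₀, beq_iff_eq] at h
  simpa only [card_ofMask, and_assoc] using h.2

theorem order_lt {m : ℕ} (hm : m < 1024) : order m < 4 := by
  rw [order]
  split_ifs
  · exact natAbs_coeff_lt (partner_lt hm)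
  · simp

/-- The degree `k` part of the basis vector attached to a mask. -/
noncomputable def col (k : ℤ) (m : ℕ) : C 5 k := eval k (entry m).vec

theorem eval_bd_vec (k : ℤ) {m : ℕ} (hm : m < 1024) :
    eval k (bd (entry m).vec) = (entry m).coeff • col k (entry m).partner := by
  by_cases h : (entry m).coeff = 0
  · rw [bd_vec_of_coeff_eq_zero hm h, h, zero_smul, eval_nil]
  · rw [(of_coeff_ne_zero hm h).2.1, eval_axpy, eval_nil, add_zero, col]

theorem d_col (k : ℤ) {m : ℕ} (hm : m < 1024) :
    d 5 k (col (k + 1) m) = (entry m).coeff • col k (entry m).partner := by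
  rw [col, d_eval, eval_bd_vec k hm]

theorem dFrom_col (k : ℤ) {m : ℕ} (hm : m < 1024) :
    dFrom 5 k (col k m) = (entry m).coeff • col (k - 1) (entry m).partner := by
  rw [col, dFrom_eval, eval_bd_vec _ hm]

theorem ofMask_bijective : Function.Bijective fun m : Fin 1024 => ofMask m := by
  rw [Fintype.bijective_iff_injective_and_card]
  refine ⟨fun m n h => Fin.ext (Nat.eq_of_testBit_eq fun i => ?_), ?_⟩
  · by_cases hi : i < 10
    · obtain ⟨p, rfl⟩ := exists_bit i hi
      have := congrArg (p ∈ ·) h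
      simpa [mem_ofMask] using this
    · have hlt (m : Fin 1024) : m.1 < 2 ^ i :=
        m.2.trans_le (Nat.pow_le_pow_right two_pos (not_lt.1 hi) : 2 ^ 10 ≤ 2 ^ i)
      rw [Nat.testBit_lt_two_pow (hlt m), Nat.testBit_lt_two_pow (hlt n)]
  · have : Fintype.card (P 5) = 10 := by decide
    rw [Fintype.card_finset, this, Fintype.card_fin]
    norm_num

/-- Masks of degree `k`. -/
abbrev Idx (k : ℤ) : Type := {m : Fin 1024 // ((ofMask m).card : ℤ) = k}

/-- The basis of wedges, indexed by masks. -/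
noncomputable def wedgeBasis (k : ℤ) : Module.Basis (Idx k) ℤ (C 5 k) :=
  Finsupp.basisSingleOne.reindex
    ((Equiv.ofBijective _ ofMask_bijective).subtypeEquiv fun _ => Iff.rfl).symm

theorem wedgeBasis_apply (k : ℤ) (m : Idx k) : wedgeBasis k m = wedge k m.1 := by
  rw [wedge, dif_pos m.2]
  simp [wedgeBasis]
  rfl

/-- The endomorphism taking wedges to reduced columns. -/
noncomputable def colMap (k : ℤ) : C 5 k →ₗ[ℤ] C 5 k :=
  (wedgeBasis k).constr ℤ fun m => col k m.1

theorem wedge_mem_range_colMap (k : ℤ) {m : ℕ} (hm : m < 1024) :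
    wedge k m ∈ LinearMap.range (colMap k) := by
  induction h : rank m using Nat.strong_induction_on generalizing m with
  | _ n ih =>
    by_cases hk : ((ofMask m).card : ℤ) = k
    · obtain ⟨v, hv, hlt⟩ := entry_vec hm
      have hmem : eval k v ∈ LinearMap.range (colMap k) := by
        refine list_sum_mem fun x hx => ?_
        obtain ⟨t, ht, rfl⟩ := List.mem_map.1 hx
        exact Submodule.smul_mem _ _ (ih _ (h ▸ (hlt t ht).2) (hlt t ht).1 rfl)
      have hcol : colMap k (wedge k m) = wedge k m + eval k v := by
        have := (wedgeBasis k).constr_basis ℤ (fun m => col k m.1) ⟨⟨m, hm⟩, hk⟩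
        rw [wedgeBasis_apply] at this
        rw [colMap, this, col, hv, eval_cons, one_smul]
      rw [← add_sub_cancel_right (wedge k m) (eval k v), ← hcol]
      exact Submodule.sub_mem _ ⟨_, rfl⟩ hmem
    · rw [wedge, dif_neg hk]
      exact Submodule.zero_mem _

theorem colMap_bijective (k : ℤ) : Function.Bijective (colMap k) := by
  refine OrzechProperty.bijective_of_surjective_endomorphism _ (LinearMap.range_eq_top.1 ?_)
  rw [eq_top_iff, ← (wedgeBasis k).span_eq, Submodule.span_le]
  rintro _ ⟨m, rfl⟩
  rw [wedgeBasis_apply]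
  exact wedge_mem_range_colMap k m.1.2

/-- The basis of reduced columns. -/
noncomputable def colBasis (k : ℤ) : Module.Basis (Idx k) ℤ (C 5 k) :=
  (wedgeBasis k).map (LinearEquiv.ofBijective _ (colMap_bijective k))

theorem colBasis_apply (k : ℤ) (m : Idx k) : colBasis k m = col k m.1 := by
  simp [colBasis, colMap]

theorem repr_col (k : ℤ) {m : ℕ} (hm : m < 1024) (hk : ((ofMask m).card : ℤ) = k) (i : Idx k) :
    (colBasis k).repr (col k m) i = if m = i.1 then 1 else 0 := by
  have := colBasis_apply k ⟨⟨m, hm⟩, hk⟩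
  rw [← this, Module.Basis.repr_self_apply]
  simp only [Subtype.ext_iff, Fin.ext_iff]

theorem order_dvd_repr_d (k : ℤ) (y : C 5 (k + 1)) (i : Idx k) :
    (order i.1 : ℤ) ∣ (colBasis k).repr (d 5 k y) i := by
  rw [← ZMod.intCast_zmod_eq_zero_iff_dvd]
  suffices h : (Int.castAddHom (ZMod (order i.1))).toIntLinearMap ∘ₗ (colBasis k).coord i ∘ₗ d 5 k =
      0 from LinearMap.congr_fun h y
  refine (colBasis (k + 1)).ext fun j => ?_
  rw [colBasis_apply]
  have hj := j.1.2
  suffices h : (order i.1 : ℤ) ∣ (colBasis k).repr (d 5 k (col (k + 1) j.1)) i from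
    (ZMod.intCast_zmod_eq_zero_iff_dvd _ _).2 h
  rw [d_col k hj, map_smul, Finsupp.smul_apply, smul_eq_mul]
  by_cases h : (entry j.1).coeff = 0
  · simp [h]
  · obtain ⟨h₀, -, hcard⟩ := of_coeff_ne_zero hj h
    rw [repr_col k (partner_lt hj) (by have := j.2; omega)]
    split_ifs with hi
    · rw [order, ← hi, if_pos h₀, partner_partner hj, mul_one, Int.natCast_natAbs, abs_dvd]
    · simp

theorem order_smul_mem_range_d (k : ℤ) {m : ℕ} (hm : m < 1024)
    (h₀ : (entry m).coeff = 0) : ∃ y, d 5 k y = (order m : ℤ) • col k m := by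
  have hp := partner_lt hm
  have h := d_col k hp
  rw [partner_partner hm] at h
  rw [order, if_pos h₀, Int.natCast_natAbs]
  obtain h' | h' := abs_choice (entry (entry m).partner).coeff
  · exact ⟨_, by rw [h, h']⟩
  · exact ⟨-_, by rw [map_neg, h, h', neg_smul]⟩

theorem repr_eq_zero_of_dFrom_eq_zero (k : ℤ) (x : C 5 k) (hx : dFrom 5 k x = 0) (i : Idx k)
    (hi : (entry i.1).coeff ≠ 0) : (colBasis k).repr x i = 0 := by
  obtain ⟨-, -, hcard⟩ := of_coeff_ne_zero i.1.2 hi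
  let p : Idx (k - 1) := ⟨⟨(entry i.1).partner, partner_lt i.1.2⟩, by have := i.2; grind⟩
  have h : (colBasis (k - 1)).coord p ∘ₗ dFrom 5 k = (entry i.1).coeff • (colBasis k).coord i := by
    refine (colBasis k).ext fun j => ?_
    have hj := j.1.2
    simp only [LinearMap.comp_apply, LinearMap.smul_apply, Module.Basis.coord_apply,
      colBasis_apply, dFrom_col k hj, map_smul, smul_eq_mul,
      repr_col k hj j.2]
    by_cases h : (entry j.1).coeff = 0
    · have : j.1.1 ≠ i.1.1 := fun hji => hi (hji ▸ h)
      simp [h, this]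
    · rw [repr_col _ (partner_lt hj) (by have := (of_coeff_ne_zero hj h).2.2; have := j.2; omega)]
      have : (entry j.1).partner = (entry i.1).partner ↔ j.1.1 = i.1.1 :=
        ⟨fun h => by rw [← partner_partner hj, h, partner_partner i.1.2], fun h => by rw [h]⟩
      by_cases hji : j.1.1 = i.1.1
      · simp [p, hji]
      · simp [p, this, hji]
  have := LinearMap.congr_fun h x
  rw [LinearMap.comp_apply, hx, map_zero, LinearMap.smul_apply, smul_eq_mul] at this
  exact (mul_eq_zero.1 this.symm).resolve_left hi

/-- Homology at `M` is a product of cyclic groups if `M` has a basis in which each vector is either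
a cycle of order `t i` modulo boundaries, or does not occur in cycles. -/
theorem nonempty_homology_equiv_pi {ι M' M M'' : Type*} [Fintype ι] [AddCommGroup M']
    [AddCommGroup M] [AddCommGroup M''] (f : M' →ₗ[ℤ] M) (g : M →ₗ[ℤ] M'')
    (b : Module.Basis ι ℤ M) (t : ι → ℕ) (hf : ∀ y i, (t i : ℤ) ∣ b.repr (f y) i)
    (hb : ∀ i, (g (b i) = 0 ∧ ∃ y, f y = (t i : ℤ) • b i) ∨
      (t i = 1 ∧ ∀ x, g x = 0 → b.repr x i = 0)) :
    Nonempty ((LinearMap.ker g ⧸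
        (LinearMap.range f ⊓ LinearMap.ker g).comap (LinearMap.ker g).subtype) ≃ₗ[ℤ]
      ((i : ι) → ZMod (t i))) := by
  classical
  let φ : LinearMap.ker g →ₗ[ℤ] ((i : ι) → ZMod (t i)) := LinearMap.pi fun i =>
    (Int.castAddHom (ZMod (t i))).toIntLinearMap ∘ₗ b.coord i ∘ₗ (LinearMap.ker g).subtype
  have φ_apply (x : LinearMap.ker g) (i : ι) : φ x i = (b.repr x.1 i : ZMod (t i)) := rfl
  have hker : LinearMap.ker φ =
      (LinearMap.range f ⊓ LinearMap.ker g).comap (LinearMap.ker g).subtype := by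
    ext x
    simp only [LinearMap.mem_ker, funext_iff, φ_apply, Pi.zero_apply,
      ZMod.intCast_zmod_eq_zero_iff_dvd, Submodule.mem_comap, Submodule.mem_inf,
      Submodule.subtype_apply]
    constructor
    · refine fun h => ⟨?_, x.2⟩
      rw [← b.sum_repr x.1]
      refine Submodule.sum_mem _ fun i _ => ?_
      obtain ⟨-, y, hy⟩ | ⟨-, hi⟩ := hb i
      · obtain ⟨c, hc⟩ := h i
        exact ⟨c • y, by rw [map_smul, hy, hc, mul_comm, mul_smul]⟩
      · rw [hi _ x.2, zero_smul]
        exact Submodule.zero_mem _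
    · rintro ⟨⟨y, hy⟩, -⟩ i
      exact hy ▸ hf y i
  have hsurj : Function.Surjective φ := by
    intro z
    choose c hc using fun i => ZMod.intCast_surjective (z i)
    let x : M := ∑ i, (if g (b i) = 0 then c i else 0) • b i
    have hx : g x = 0 := by
      rw [map_sum]
      refine Finset.sum_eq_zero fun i _ => ?_
      split_ifs with h <;> simp [h]
    refine ⟨⟨x, hx⟩, funext fun i => ?_⟩
    rw [φ_apply, b.repr_sum_self]
    obtain ⟨hi, -⟩ | ⟨hi, -⟩ := hb i
    · rw [if_pos hi, hc]
    · have : Subsingleton (ZMod (t i)) := by rw [hi]; infer_instance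
      exact Subsingleton.elim _ _
  exact ⟨(Submodule.quotEquivOfEq _ _ hker.symm).trans (φ.quotKerEquivOfSurjective hsurj)⟩

/-- Collect the factors of a product of cyclic groups of orders `0`, `1`, `2` and `3`. -/
theorem nonempty_pi_zmod_equiv {ι : Type*} [Fintype ι] (t : ι → ℕ) (ht : ∀ i, t i < 4) {a b c : ℕ}
    (ha : Fintype.card {i // t i = 0} = a) (hb : Fintype.card {i // t i = 2} = b)
    (hc : Fintype.card {i // t i = 3} = c) :
    Nonempty (((i : ι) → ZMod (t i)) ≃ₗ[ℤ]
      (Fin a → ℤ) × (Fin b → ZMod 2) × (Fin c → ZMod 3)) := by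
  let e (n : ℕ) (i : {i // t i = n}) : ZMod (t i) ≃ₗ[ℤ] ZMod n :=
    (ZMod.ringEquivCongr i.2).toAddEquiv.toIntLinearEquiv
  let π (n : ℕ) : ((i : ι) → ZMod (t i)) →ₗ[ℤ] ({i // t i = n} → ZMod n) :=
    LinearMap.pi fun i => (e n i).toLinearMap ∘ₗ LinearMap.proj i.1
  have π_apply (n : ℕ) (x : (i : ι) → ZMod (t i)) (i : {i // t i = n}) : π n x i = e n i (x i) := rfl
  have hbij : Function.Bijective ((π 0).prod ((π 2).prod (π 3))) := by
    constructor
    · rw [injective_iff_map_eq_zero]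
      intro x hx
      simp only [LinearMap.prod_apply, Function.prod, Prod.mk_eq_zero] at hx
      have key (n : ℕ) (hn : π n x = 0) (i : ι) (hi : t i = n) : x i = 0 :=
        (e n ⟨i, hi⟩).map_eq_zero_iff.1 (congrFun hn ⟨i, hi⟩)
      funext i
      obtain hi | hi | hi | hi : t i = 0 ∨ t i = 1 ∨ t i = 2 ∨ t i = 3 := by
        have := ht i
        omega
      · exact key 0 hx.1 i hi
      · have : Subsingleton (ZMod (t i)) := by rw [hi]; infer_instance
        exact Subsingleton.elim _ _
      · exact key 2 hx.2.1 i hi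
      · exact key 3 hx.2.2 i hi
    · rintro ⟨x, y, z⟩
      refine ⟨fun i => if h : t i = 0 then (e 0 ⟨i, h⟩).symm (x ⟨i, h⟩)
        else if h : t i = 2 then (e 2 ⟨i, h⟩).symm (y ⟨i, h⟩)
        else if h : t i = 3 then (e 3 ⟨i, h⟩).symm (z ⟨i, h⟩) else 0, ?_⟩
      simp only [LinearMap.prod_apply, Function.prod, Prod.mk.injEq]
      refine ⟨funext fun i => ?_, funext fun i => ?_, funext fun i => ?_⟩ <;>
        simp [π_apply, i.2]
  exact ⟨(LinearEquiv.ofBijective _ hbij).trans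
    ((LinearEquiv.funCongrLeft ℤ ℤ (Fintype.equivFinOfCardEq ha).symm).prodCongr
      ((LinearEquiv.funCongrLeft ℤ (ZMod 2) (Fintype.equivFinOfCardEq hb).symm).prodCongr
        (LinearEquiv.funCongrLeft ℤ (ZMod 3) (Fintype.equivFinOfCardEq hc).symm)))⟩

theorem nonempty_hnil_equiv_pi (k : ℤ) :
    Nonempty (Hnil 5 k ≃ₗ[ℤ] ((i : Idx k) → ZMod (order i.1))) := by
  refine nonempty_homology_equiv_pi (d 5 k) (dFrom 5 k) (colBasis k) _ (order_dvd_repr_d k)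
    fun i => ?_
  by_cases h : (entry i.1).coeff = 0
  · left
    rw [colBasis_apply]
    exact ⟨by rw [dFrom_col k i.1.2, h, zero_smul], order_smul_mem_range_d k i.1.2 h⟩
  · right
    exact ⟨by rw [order, if_neg h], fun x hx => repr_eq_zero_of_dFrom_eq_zero k x hx i h⟩

theorem card_order_eq (k c : ℕ) (hc : c ≠ 1) :
    Fintype.card {i : Idx k // order i.1 = c} = numCycles k c := by
  have : numCycles k c =
      ((Finset.range 1024).filter fun m => pop m 10 = k ∧ order m = c).card := by
    rw [numCycles, essential, List.filter_filter, List.countP_filter, List.countP_eq_length_filter,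
      Finset.card, Finset.filter_val, Finset.range_val, Multiset.range, Multiset.filter_coe,
      Multiset.coe_card]
    congr 2
    funext m
    rw [Bool.eq_iff_iff]
    by_cases h : order m = c <;> simp [h, hc]
  rw [this, ← Fintype.card_coe]
  exact Fintype.card_congr
    { toFun := fun i => ⟨i.1.1, by
        have h := i.1.2
        rw [card_ofMask] at h
        exact Finset.mem_filter.2
          ⟨Finset.mem_range.2 i.1.1.2, Int.natCast_inj.1 h, i.2⟩⟩
      invFun := fun m =>
        have h := Finset.mem_filter.1 m.2
        ⟨⟨⟨m.1, Finset.mem_range.1 h.1⟩, by rw [card_ofMask, h.2.1]⟩, h.2.2⟩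
      left_inv := fun _ => rfl
      right_inv := fun _ => rfl }

theorem nonempty_hnil_equiv {l : ℤ} {k a b c : ℕ} (hl : l = k)
    (h : [numCycles k 0, numCycles k 2, numCycles k 3] = [a, b, c]) :
    Nonempty (Hnil 5 l ≃ₗ[ℤ] (Fin a → ℤ) × (Fin b → ZMod 2) × (Fin c → ZMod 3)) := by
  subst hl
  simp only [List.cons.injEq, and_true] at h
  obtain ⟨e⟩ := nonempty_hnil_equiv_pi k
  obtain ⟨e'⟩ := nonempty_pi_zmod_equiv (fun i : Idx k => order i.1) (fun i => order_lt i.1.2)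
    ((card_order_eq k 0 (by decide)).trans h.1) ((card_order_eq k 2 (by decide)).trans h.2.1)
    ((card_order_eq k 3 (by decide)).trans h.2.2)
  exact ⟨e.trans e'⟩

theorem nonempty_hnil_equiv_two {l : ℤ} {k a b : ℕ} (hl : l = k)
    (h : [numCycles k 0, numCycles k 2, numCycles k 3] = [a, b, 0]) :
    Nonempty (Hnil 5 l ≃ₗ[ℤ] (Fin a → ℤ) × (Fin b → ZMod 2)) :=
  (nonempty_hnil_equiv hl h).map fun e =>
    e.trans ((LinearEquiv.refl ℤ _).prodCongr LinearEquiv.prodUnique)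

theorem nonempty_hnil_equiv_free {l : ℤ} {k a : ℕ} (hl : l = k)
    (h : [numCycles k 0, numCycles k 2, numCycles k 3] = [a, 0, 0]) :
    Nonempty (Hnil 5 l ≃ₗ[ℤ] (Fin a → ℤ)) :=
  (nonempty_hnil_equiv_two hl h).map fun e => e.trans LinearEquiv.prodUnique

theorem subsingleton_hnil {k : ℤ} (hk : 10 < k) : Subsingleton (Hnil 5 k) := by
  obtain ⟨e⟩ := nonempty_hnil_equiv_pi k
  have : IsEmpty (Idx k) := ⟨fun i => by
    have h := Finset.card_le_univ (ofMask i.1)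
    have hP : Fintype.card (P 5) = 10 := by decide
    have := i.2
    omega⟩
  exact e.toEquiv.subsingleton

/-- The complete integral homology of `nil_5`. -/
theorem nil5_homology :
    Nonempty (Hnil 5 0 ≃ₗ[ℤ] ℤ) ∧
    Nonempty (Hnil 5 1 ≃ₗ[ℤ] (Fin 4 → ℤ)) ∧
    Nonempty (Hnil 5 2 ≃ₗ[ℤ] (Fin 9 → ℤ) × (Fin 2 → ZMod 2)) ∧
    Nonempty (Hnil 5 3 ≃ₗ[ℤ] (Fin 15 → ℤ) × (Fin 8 → ZMod 2) × (Fin 2 → ZMod 3)) ∧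
    Nonempty (Hnil 5 4 ≃ₗ[ℤ] (Fin 20 → ℤ) × (Fin 10 → ZMod 2) × (Fin 3 → ZMod 3)) ∧
    Nonempty (Hnil 5 5 ≃ₗ[ℤ] (Fin 22 → ℤ) × (Fin 10 → ZMod 2) × (Fin 3 → ZMod 3)) ∧
    Nonempty (Hnil 5 6 ≃ₗ[ℤ] (Fin 20 → ℤ) × (Fin 8 → ZMod 2) × (Fin 2 → ZMod 3)) ∧
    Nonempty (Hnil 5 7 ≃ₗ[ℤ] (Fin 15 → ℤ) × (Fin 2 → ZMod 2)) ∧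
    Nonempty (Hnil 5 8 ≃ₗ[ℤ] (Fin 9 → ℤ)) ∧
    Nonempty (Hnil 5 9 ≃ₗ[ℤ] (Fin 4 → ℤ)) ∧
    Nonempty (Hnil 5 10 ≃ₗ[ℤ] ℤ) ∧
    (∀ k : ℤ, 10 < k → Subsingleton (Hnil 5 k)) := by
  have h := numCycles_eq
  simp only [List.range_succ_eq_map, List.range_zero, List.map_cons, List.map_nil,
    List.cons.injEq (_ : List ℕ), and_true] at h
  obtain ⟨h0, h1, h2, h3, h4, h5, h6, h7, h8, h9, h10⟩ := h
  have e : (Fin 1 → ℤ) ≃ₗ[ℤ] ℤ := LinearEquiv.funUnique (Fin 1) ℤ ℤ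
  exact ⟨(nonempty_hnil_equiv_free rfl h0).map fun e₀ => e₀.trans e,
    nonempty_hnil_equiv_free rfl h1, nonempty_hnil_equiv_two rfl h2,
    nonempty_hnil_equiv rfl h3, nonempty_hnil_equiv rfl h4, nonempty_hnil_equiv rfl h5,
    nonempty_hnil_equiv rfl h6, nonempty_hnil_equiv_two rfl h7,
    nonempty_hnil_equiv_free rfl h8, nonempty_hnil_equiv_free rfl h9,
    (nonempty_hnil_equiv_free rfl h10).map fun e₀ => e₀.trans e,
    fun _ hk => subsingleton_hnil hk⟩

end Nil
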